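/- Let p ∈ C[z] be a nonzero polynomial with p(0) = 0 and positive degree, and let q ∈ C[z]. Consider the operator L = p(D) + q(x), whose adjoint acts on C(x) by L*(r) = Σ_i (-1)^i p_i r^{(i)} + q·r, where p = Σ_i p_i z^i. Then Sind(L) = max{deg(q), 0}, where deg(q) is taken to be 0 when q = 0. In particular, if q ≠ 0 then no polynomial of degree deg(q) - 1 lies in the image of L* on C(x), while for every i ≥ deg(q) some polynomial of degree i does. -/

import Mathlib

open Polynomial

/-- The derivative of a rational function, computed via the quotient rule on the
reduced numerator/denominator representation. -/
noncomputable def rderiv {C : Type} [Field C] (f : RatFunc C) : RatFunc C :=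
  algebraMap (Polynomial C) (RatFunc C)
      (derivative f.num * f.denom - f.num * derivative f.denom) /
    algebraMap (Polynomial C) (RatFunc C) (f.denom ^ 2)

/-- The adjoint of the Katz-type operator `L = p(D) + q(x)` applied to `r`:
`L*(r) = Σ_i (-1)^i p_i r^{(i)} + q * r` where `p = Σ_i p_i z^i`. -/
noncomputable def adjKatz {C : Type} [Field C] (p q : Polynomial C) (r : RatFunc C) :
    RatFunc C :=
  (∑ i ∈ Finset.range (p.natDegree + 1),
      (-1 : RatFunc C) ^ i * RatFunc.C (p.coeff i) * rderiv^[i] r) +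
    algebraMap (Polynomial C) (RatFunc C) q * r

/-- The stability index of an operator with adjoint action `adj` on `C(x)`: the minimal
`m` such that for every `i ≥ m` there is a polynomial of degree `i` in the image of the
adjoint on `C(x)`. -/
noncomputable def sindOf {C : Type} [Field C] (adj : RatFunc C → RatFunc C) : ℕ :=
  sInf {m : ℕ | ∀ i : ℕ, m ≤ i → ∃ p : Polynomial C, p.degree = (i : ℕ) ∧
    ∃ r : RatFunc C, adj r = algebraMap (Polynomial C) (RatFunc C) p}

theorem rderiv_div {C : Type} [Field C] (u v : C[X]) (hv : v ≠ 0) :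
    rderiv (algebraMap C[X] (RatFunc C) u / algebraMap C[X] (RatFunc C) v) =
      algebraMap C[X] (RatFunc C) (derivative u * v - u * derivative v) /
        algebraMap C[X] (RatFunc C) (v ^ 2) := by
  set f := algebraMap C[X] (RatFunc C) u / algebraMap C[X] (RatFunc C) v with hf
  have hd : f.denom ≠ 0 := f.denom_ne_zero
  have hcross : f.num * v = u * f.denom := by
    have h := (RatFunc.num_div_denom f).trans hf
    rw [div_eq_div_iff (RatFunc.algebraMap_ne_zero hd) (RatFunc.algebraMap_ne_zero hv)] at h
    exact RatFunc.algebraMap_injective C (by simpa using h)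
  have hder := congrArg derivative hcross
  simp only [derivative_mul] at hder
  rw [rderiv, div_eq_div_iff (RatFunc.algebraMap_ne_zero (pow_ne_zero _ hd))
    (RatFunc.algebraMap_ne_zero (pow_ne_zero _ hv)), ← map_mul, ← map_mul]
  congr 1
  linear_combination f.denom * v * hder -
    (f.denom * derivative v + v * derivative f.denom) * hcross

theorem rderiv_algebraMap {C : Type} [Field C] (u : C[X]) :
    rderiv (algebraMap C[X] (RatFunc C) u) = algebraMap C[X] (RatFunc C) (derivative u) := by
  simpa using rderiv_div u 1 one_ne_zero

theorem iterate_rderiv_algebraMap {C : Type} [Field C] (u : C[X]) (i : ℕ) :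
    rderiv^[i] (algebraMap C[X] (RatFunc C) u) =
      algebraMap C[X] (RatFunc C) (derivative^[i] u) := by
  induction i with
  | zero => rfl
  | succ i ih => rw [Function.iterate_succ_apply', ih, rderiv_algebraMap,
      Function.iterate_succ_apply']

/-- The rational function `r` has a pole of order at most `s` at `a`. -/
def PoleOrderLE {C : Type} [Field C] (a : C) (s : ℕ) (r : RatFunc C) : Prop :=
  ∃ u v : C[X], v.eval a ≠ 0 ∧
    r * algebraMap C[X] (RatFunc C) ((X - Polynomial.C a) ^ s * v) = algebraMap C[X] (RatFunc C) u

/-- The rational function `r` has a pole of order exactly `s` at `a`. -/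
def PoleOrderEq {C : Type} [Field C] (a : C) (s : ℕ) (r : RatFunc C) : Prop :=
  ∃ u v : C[X], u.eval a ≠ 0 ∧ v.eval a ≠ 0 ∧
    r * algebraMap C[X] (RatFunc C) ((X - Polynomial.C a) ^ s * v) = algebraMap C[X] (RatFunc C) u

section Poles

variable {C : Type} [Field C] {a : C} {s t : ℕ} {r r₁ r₂ : RatFunc C}

theorem PoleOrderEq.le (h : PoleOrderEq a s r) : PoleOrderLE a s r := by
  obtain ⟨u, v, -, hv, h⟩ := h
  exact ⟨u, v, hv, h⟩

theorem PoleOrderLE.mono (h : PoleOrderLE a s r) (hst : s ≤ t) : PoleOrderLE a t r := by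
  obtain ⟨u, v, hv, h⟩ := h
  obtain ⟨k, rfl⟩ := Nat.exists_eq_add_of_le hst
  refine ⟨u * (X - Polynomial.C a) ^ k, v, hv, ?_⟩
  rw [map_mul _ u, ← h, mul_assoc, ← map_mul]
  congr 2
  ring

theorem PoleOrderLE.add (h₁ : PoleOrderLE a s r₁) (h₂ : PoleOrderLE a s r₂) :
    PoleOrderLE a s (r₁ + r₂) := by
  obtain ⟨u, v, hv, h⟩ := h₁
  obtain ⟨u', v', hv', h'⟩ := h₂
  refine ⟨u * v' + u' * v, v * v', by simp [hv, hv'], ?_⟩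
  simp only [map_mul, map_add] at h h' ⊢
  linear_combination algebraMap C[X] (RatFunc C) v' * h + algebraMap C[X] (RatFunc C) v * h'

theorem poleOrderLE_zero : PoleOrderLE a s (0 : RatFunc C) :=
  ⟨0, 1, by simp, by simp⟩

theorem PoleOrderLE.algebraMap_mul (w : C[X]) (h : PoleOrderLE a s r) :
    PoleOrderLE a s (algebraMap C[X] (RatFunc C) w * r) := by
  obtain ⟨u, v, hv, h⟩ := h
  exact ⟨w * u, v, hv, by rw [mul_assoc, h, map_mul]⟩

theorem poleOrderLE_sum {ι : Type*} (I : Finset ι) (f : ι → RatFunc C)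
    (h : ∀ i ∈ I, PoleOrderLE a s (f i)) : PoleOrderLE a s (∑ i ∈ I, f i) :=
  Finset.sum_induction f _ (fun _ _ => PoleOrderLE.add) poleOrderLE_zero h

theorem PoleOrderEq.algebraMap_mul {w : C[X]} (hw : w.eval a ≠ 0) (h : PoleOrderEq a s r) :
    PoleOrderEq a s (algebraMap C[X] (RatFunc C) w * r) := by
  obtain ⟨u, v, hu, hv, h⟩ := h
  exact ⟨w * u, v, by simp [hw, hu], hv, by rw [mul_assoc, h, map_mul]⟩

theorem PoleOrderEq.add_poleOrderLE (h₁ : PoleOrderEq a (s + 1) r₁) (h₂ : PoleOrderLE a s r₂) :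
    PoleOrderEq a (s + 1) (r₁ + r₂) := by
  obtain ⟨u, v, hu, hv, h⟩ := h₁
  obtain ⟨u', v', hv', h'⟩ := h₂
  refine ⟨u * v' + u' * v * (X - Polynomial.C a), v * v', by simp [hu, hv'], by simp [hv, hv'], ?_⟩
  simp only [map_mul, map_add, pow_succ] at h h' ⊢
  linear_combination algebraMap C[X] (RatFunc C) v' * h + algebraMap C[X] (RatFunc C) v *
    algebraMap C[X] (RatFunc C) (X - Polynomial.C a) * h'

theorem not_poleOrderEq_algebraMap (d : C[X]) :
    ¬ PoleOrderEq a (s + 1) (algebraMap C[X] (RatFunc C) d) := by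
  rintro ⟨u, v, hu, -, h⟩
  rw [← map_mul] at h
  rw [← RatFunc.algebraMap_injective C h] at hu
  simp at hu

theorem poleOrderEq_rderiv [CharZero C] (h : PoleOrderEq a (s + 1) r) :
    PoleOrderEq a (s + 2) (rderiv r) := by
  obtain ⟨u, v, hu, hv, h⟩ := h
  have hv0 : v ≠ 0 := by rintro rfl; simp at hv
  have hX : (X - Polynomial.C a) ≠ 0 := X_sub_C_ne_zero a
  have hne : (X - Polynomial.C a) ^ (s + 1) * v ≠ 0 := mul_ne_zero (pow_ne_zero _ hX) hv0
  rw [← eq_div_iff (RatFunc.algebraMap_ne_zero hne)] at h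
  have hs : (s + 1 : C) ≠ 0 := by exact_mod_cast s.succ_ne_zero
  refine ⟨derivative u * (X - Polynomial.C a) * v - Polynomial.C (s + 1 : C) * u * v -
    u * (X - Polynomial.C a) * derivative v, v ^ 2, ?_,
    by simpa using hv, ?_⟩
  · simp [hu, hv, hs]
  · rw [h, rderiv_div _ _ hne, div_mul_eq_mul_div,
      div_eq_iff (RatFunc.algebraMap_ne_zero (pow_ne_zero _ hne)), ← map_mul, ← map_mul]
    refine congrArg (algebraMap C[X] (RatFunc C)) ?_
    rw [derivative_mul, derivative_X_sub_C_pow, Nat.add_sub_cancel, Nat.cast_succ]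
    ring

theorem poleOrderEq_iterate_rderiv [CharZero C] (h : PoleOrderEq a (s + 1) r) (i : ℕ) :
    PoleOrderEq a (s + i + 1) (rderiv^[i] r) := by
  induction i with
  | zero => exact h
  | succ i ih =>
    rw [Function.iterate_succ_apply']
    exact poleOrderEq_rderiv ih

theorem exists_poleOrderEq_or_eq_algebraMap [IsAlgClosed C] (r : RatFunc C) :
    (∃ a s, PoleOrderEq a (s + 1) r) ∨ ∃ f : C[X], r = algebraMap C[X] (RatFunc C) f := by
  by_cases hdeg : r.denom.degree = 0
  · right
    have h1 : r.denom = 1 := (RatFunc.monic_denom r).degree_le_zero_iff_eq_one.1 hdeg.le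
    refine ⟨r.num, ?_⟩
    conv_lhs => rw [← RatFunc.num_div_denom r, h1]
    simp
  · left
    obtain ⟨a, ha⟩ := IsAlgClosed.exists_root r.denom hdeg
    obtain ⟨v, hv, hdvd⟩ := exists_eq_pow_rootMultiplicity_mul_and_not_dvd r.denom
      r.denom_ne_zero a
    have hpos : 0 < rootMultiplicity a r.denom :=
      (rootMultiplicity_pos r.denom_ne_zero).2 ha
    obtain ⟨s, hs⟩ := Nat.exists_eq_succ_of_ne_zero hpos.ne'
    rw [hs] at hv
    refine ⟨a, s, r.num, v, ?_, ?_, ?_⟩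
    · intro hnum
      obtain ⟨x, y, hxy⟩ := RatFunc.isCoprime_num_denom r
      have := congrArg (eval a) hxy
      simp [hnum, ha.eq_zero] at this
    · rwa [dvd_iff_isRoot] at hdvd
    · rw [← hv]
      exact (eq_div_iff (RatFunc.algebraMap_ne_zero r.denom_ne_zero)).1
        (RatFunc.num_div_denom r).symm

end Poles

/-- The action of the adjoint of `p(D) + q(x)` on polynomials. -/
noncomputable def polyAdjKatz {C : Type} [Field C] (p q f : C[X]) : C[X] :=
  (∑ i ∈ Finset.range (p.natDegree + 1),
    Polynomial.C ((-1) ^ i * p.coeff i) * derivative^[i] f) + q * f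

section Katz

variable {C : Type} [Field C] {p q : C[X]}

theorem adjKatz_algebraMap (p q f : C[X]) :
    adjKatz p q (algebraMap C[X] (RatFunc C) f) =
      algebraMap C[X] (RatFunc C) (polyAdjKatz p q f) := by
  simp [adjKatz, polyAdjKatz, iterate_rderiv_algebraMap, RatFunc.algebraMap_C]

theorem poleOrderEq_adjKatz [CharZero C] {a : C} {s : ℕ} {r : RatFunc C}
    (hp : 0 < p.natDegree) (h : PoleOrderEq a (s + 1) r) :
    PoleOrderEq a (s + p.natDegree + 1) (adjKatz p q r) := by
  have hterm (i : ℕ) : (-1 : RatFunc C) ^ i * RatFunc.C (p.coeff i) =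
      algebraMap C[X] (RatFunc C) (Polynomial.C ((-1) ^ i * p.coeff i)) := by
    simp [RatFunc.algebraMap_C]
  have hlead : p.coeff p.natDegree ≠ 0 := by
    rw [coeff_natDegree, leadingCoeff_ne_zero]
    rintro rfl
    simp at hp
  rw [adjKatz, Finset.sum_range_succ, add_comm (Finset.sum (Finset.range p.natDegree) _)]
  refine PoleOrderEq.add_poleOrderLE (PoleOrderEq.add_poleOrderLE ?_
    (poleOrderLE_sum (Finset.range p.natDegree) _ fun i hi => ?_)) ?_
  · rw [hterm]
    exact (poleOrderEq_iterate_rderiv h _).algebraMap_mul (by simpa using hlead)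
  · rw [hterm]
    have hi := Finset.mem_range.1 hi
    exact ((poleOrderEq_iterate_rderiv h i).le.mono (by omega)).algebraMap_mul _
  · exact (h.le.mono (by omega)).algebraMap_mul _

theorem exists_polyAdjKatz_eq [IsAlgClosed C] [CharZero C] (hp : 0 < p.natDegree) {d : C[X]}
    {r : RatFunc C} (h : adjKatz p q r = algebraMap C[X] (RatFunc C) d) :
    ∃ f, polyAdjKatz p q f = d := by
  obtain ⟨a, s, hr⟩ | ⟨f, rfl⟩ := exists_poleOrderEq_or_eq_algebraMap r
  · exact absurd (h ▸ poleOrderEq_adjKatz hp hr) (not_poleOrderEq_algebraMap d)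
  · exact ⟨f, RatFunc.algebraMap_injective C (by rw [← adjKatz_algebraMap, h])⟩

theorem degree_iterate_derivative_lt {f : C[X]} (hf : f ≠ 0) {i : ℕ} (hi : i ≠ 0) :
    (derivative^[i] f).degree < f.degree := by
  obtain ⟨i, rfl⟩ := Nat.exists_eq_succ_of_ne_zero hi
  induction i with
  | zero => exact degree_derivative_lt hf
  | succ i ih =>
    rw [Function.iterate_succ_apply']
    exact (degree_derivative_le).trans_lt (ih (by simp))

theorem degree_polyAdjKatz (hp : p.coeff 0 = 0) (hq : q ≠ 0) (f : C[X]) :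
    (polyAdjKatz p q f).degree = q.degree + f.degree := by
  rcases eq_or_ne f 0 with rfl | hf
  · simp [polyAdjKatz]
  rw [polyAdjKatz, degree_add_eq_right_of_degree_lt, degree_mul]
  refine lt_of_lt_of_le (b := f.degree) ?_ ?_
  · rw [degree_eq_natDegree hf, degree_lt_iff_coeff_zero]
    intro m hm
    rw [finsetSum_coeff]
    refine Finset.sum_eq_zero fun i _ => ?_
    rcases eq_or_ne i 0 with rfl | hi
    · simp [hp]
    · rw [coeff_C_mul, coeff_eq_zero_of_degree_lt (n := m), mul_zero]
      exact (degree_iterate_derivative_lt hf hi).trans_le (degree_le_of_natDegree_le hm)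
  · rw [mul_comm]
    exact degree_le_mul_left f hq

theorem degree_polyAdjKatz_zero_X_pow [CharZero C] (hp : p ≠ 0) (i : ℕ) :
    (polyAdjKatz p 0 (X ^ (i + p.natTrailingDegree))).degree = i := by
  have hcoeff (m : ℕ) : (polyAdjKatz p 0 (X ^ (i + p.natTrailingDegree))).coeff m =
      ∑ l ∈ Finset.range (p.natDegree + 1), (-1) ^ l * p.coeff l *
        ((m + l).descFactorial l * if m + l = i + p.natTrailingDegree then 1 else 0) := by
    simp only [polyAdjKatz, zero_mul, add_zero, finsetSum_coeff, coeff_C_mul,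
      coeff_iterate_derivative, coeff_X_pow, nsmul_eq_mul]
  refine degree_eq_of_le_of_coeff_ne_zero ((degree_le_iff_coeff_zero _ _).2 fun m hm => ?_) ?_
  · rw [hcoeff]
    refine Finset.sum_eq_zero fun l _ => ?_
    have hm : i < m := by exact_mod_cast hm
    rcases lt_or_ge l p.natTrailingDegree with hl | hl
    · simp [coeff_eq_zero_of_lt_natTrailingDegree hl]
    · rw [if_neg (by omega)]
      simp
  · rw [hcoeff, Finset.sum_eq_single p.natTrailingDegree]
    · have : p.coeff p.natTrailingDegree ≠ 0 := by simpa using hp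
      have h2 : (i + p.natTrailingDegree).descFactorial p.natTrailingDegree ≠ 0 := by
        simp [Nat.descFactorial_eq_zero_iff_lt]
      simp [this, h2, hp]
    · intro l _ hl
      rw [if_neg (by omega)]
      simp
    · intro h
      exact absurd (Finset.mem_range.2 (Nat.lt_succ_of_le p.natTrailingDegree_le_natDegree)) h

end Katz

/-- Proposition 4.3. For a Katz-type operator `L = p(D) + q(x)` with
`p(0) = 0` and `deg p > 0`, one has `Sind(L) = max{deg q, 0}`. In particular, if `q ≠ 0`
then no polynomial of degree `deg(q) - 1` is in the image of `L*` on `C(x)`, while for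
every `i ≥ deg q` some polynomial of degree `i` is. -/
theorem sind_katz_operator {C : Type} [Field C] [IsAlgClosed C] [CharZero C]
    (p q : Polynomial C) (hp0 : p.coeff 0 = 0) (hpdeg : 0 < p.natDegree) :
    sindOf (adjKatz p q) = max q.natDegree 0 ∧
    (q ≠ 0 → ∀ d : Polynomial C, d.degree + 1 = q.degree →
      ¬∃ r : RatFunc C, adjKatz p q r = algebraMap (Polynomial C) (RatFunc C) d) ∧
    (∀ i : ℕ, q.natDegree ≤ i → ∃ d : Polynomial C, d.degree = (i : ℕ) ∧
      ∃ r : RatFunc C, adjKatz p q r = algebraMap (Polynomial C) (RatFunc C) d) := by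
  have hp : p ≠ 0 := by
    rintro rfl
    simp at hpdeg
  have hnot : q ≠ 0 → ∀ d : Polynomial C, d.degree + 1 = q.degree →
      ¬∃ r : RatFunc C, adjKatz p q r = algebraMap (Polynomial C) (RatFunc C) d := by
    rintro hq d hd ⟨r, hr⟩
    obtain ⟨f, rfl⟩ := exists_polyAdjKatz_eq hpdeg hr
    rw [degree_polyAdjKatz hp0 hq] at hd
    rcases eq_or_ne f 0 with rfl | hf
    · exact hq (degree_eq_bot.1 (by simpa using hd.symm))
    · rw [degree_eq_natDegree hf, degree_eq_natDegree hq] at hd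
      norm_cast at hd
      omega
  have hex : ∀ i : ℕ, q.natDegree ≤ i → ∃ d : Polynomial C, d.degree = (i : ℕ) ∧
      ∃ r : RatFunc C, adjKatz p q r = algebraMap (Polynomial C) (RatFunc C) d := by
    intro i hi
    rcases eq_or_ne q 0 with rfl | hq
    · exact ⟨_, degree_polyAdjKatz_zero_X_pow hp i, _, adjKatz_algebraMap _ _ _⟩
    · refine ⟨_, ?_, _, adjKatz_algebraMap p q (X ^ (i - q.natDegree))⟩
      rw [degree_polyAdjKatz hp0 hq, degree_X_pow, degree_eq_natDegree hq]
      norm_cast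
      omega
  refine ⟨?_, hnot, hex⟩
  rw [Nat.max_zero]
  refine le_antisymm (Nat.sInf_le hex) (le_csInf ⟨_, hex⟩ fun m hm => ?_)
  by_contra! hlt
  obtain ⟨d, hd, hr⟩ := hm (q.natDegree - 1) (by omega)
  have hq : q ≠ 0 := by
    rintro rfl
    simp at hlt
  refine hnot hq d ?_ hr
  rw [hd, degree_eq_natDegree hq]
  norm_cast
  omega
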